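/- Let μ be a locally finite Borel measure on ℝ^d without point masses, let (g_i)_{i=1}^∞ be a sequence of non-negative measurable functions in L¹(μ), and let C ≥ 1. Then the following are equivalent: (1) ∑_{i=1}^∞ a_i ≤ C · ∫ sup_{i≥1} a_i g_i dμ for every sequence (a_i)_{i=1}^∞ of non-negative reals; (2) there exist pairwise disjoint measurable sets E_1, E_2, … in ℝ^d such that 1 ≤ C · ∫_{E_i} g_i dμ for every i = 1, 2, …. -/

import Mathlib

open MeasureTheory Set
open scoped NNReal ENNReal

namespace DorAux

set_option linter.unusedSectionVars false

section
variable {X : Type*} [MeasurableSpace X]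

theorem wd_lc (H : Type*) [NormedAddCommGroup H] [NormedSpace ℝ H] :
    LocallyConvexSpace ℝ (WeakDual ℝ H) :=
  WeakBilin.locallyConvexSpace (B := topDualPairing ℝ H)

theorem split_set [MeasurableSpace.CountablySeparated X] (ν : Measure X)
    (hν : ∀ x, ν {x} = 0) (A : Set X) (hA : MeasurableSet A) (hpos : ν A ≠ 0) :
    ∃ B ⊆ A, MeasurableSet B ∧ ν B ≠ 0 ∧ ν (A \ B) ≠ 0 := by
  by_contra! hcon
  have := MeasurableSpace.CountablySeparated.countably_separated (α := X)
  obtain ⟨t, ht, htl⟩ := Filter.exists_subsingleton_mem_of_forall_separating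
    (l := ae (ν.restrict A)) MeasurableSet (by
      intro U hU
      rw [mem_ae_iff, mem_ae_iff, compl_compl, Measure.restrict_apply hU,
        Measure.restrict_apply hU.compl]
      by_cases h : ν (U ∩ A) = 0
      · exact Or.inr h
      · left
        have := hcon (U ∩ A) inter_subset_right (hU.inter hA) h
        convert this using 2
        ext x; simp; tauto)
  rw [mem_ae_iff, Measure.restrict_apply' hA] at htl
  apply hpos
  have h0 : ν t = 0 := by
    rcases ht.eq_empty_or_singleton with rfl | ⟨x, rfl⟩
    · simp
    · exact hν x
  refine measure_mono_null (t := (tᶜ ∩ A) ∪ t) (fun x hx => ?_) (measure_union_null htl h0)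
  by_cases h : x ∈ t <;> simp [h, hx]

theorem split_three [MeasurableSpace.CountablySeparated X] (ν : Measure X)
    (hν : ∀ x, ν {x} = 0) (A : Set X) (hA : MeasurableSet A) (hpos : ν A ≠ 0) :
    ∃ B : Fin 3 → Set X, (∀ i, B i ⊆ A) ∧ (∀ i, MeasurableSet (B i)) ∧ (∀ i, ν (B i) ≠ 0) ∧
      Pairwise (Function.onFun Disjoint B) := by
  obtain ⟨B, hBA, hB, hB0, hB1⟩ := split_set ν hν A hA hpos
  obtain ⟨D, hDA, hD, hD0, hD1⟩ := split_set ν hν (A \ B) (hA.diff hB) hB1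
  have d1 : Disjoint B D := (disjoint_sdiff_right).mono_right hDA
  have d2 : Disjoint B ((A \ B) \ D) := (disjoint_sdiff_right).mono_right sdiff_subset
  have d3 : Disjoint D ((A \ B) \ D) := disjoint_sdiff_right
  refine ⟨![B, D, (A \ B) \ D], ?_, ?_, ?_, ?_⟩
  · intro i; fin_cases i
    · exact hBA
    · exact hDA.trans sdiff_subset
    · exact sdiff_subset.trans sdiff_subset
  · intro i; fin_cases i
    · exact hB
    · exact hD
    · exact (hA.diff hB).diff hD
  · intro i; fin_cases i
    · exact hB0
    · exact hD0
    · exact hD1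
  · intro i j hij
    fin_cases i <;> fin_cases j <;> simp [Function.onFun] at hij ⊢ <;>
      first | assumption | (apply Disjoint.symm; assumption)

noncomputable def J (ν : Measure X) [IsFiniteMeasure ν] (A : Set X) (hA : MeasurableSet A) :
    Lp ℝ 2 ν →L[ℝ] ℝ :=
  innerSL ℝ (indicatorConstLp 2 hA (measure_ne_top ν A) (1 : ℝ))

variable (ν : Measure X) [IsFiniteMeasure ν]

theorem J_apply (A : Set X) (hA : MeasurableSet A) (f : Lp ℝ 2 ν) :
    J ν A hA f = ∫ x in A, f x ∂ν := by
  simp [J, L2.inner_indicatorConstLp_one]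

theorem int_Lp (f : Lp ℝ 2 ν) : Integrable f ν :=
  (Lp.memLp f).integrable (by norm_num)

theorem J_nonneg (A : Set X) (hA : MeasurableSet A) (f : Lp ℝ 2 ν) (hf : 0 ≤ f) :
    0 ≤ J ν A hA f := by
  rw [J_apply]
  apply integral_nonneg_of_ae
  exact ae_restrict_of_ae ((Lp.coeFn_nonneg f).2 hf)

theorem J_sum_le {ι : Type*} (s : Finset ι) (B : ι → Set X) (hB : ∀ i, MeasurableSet (B i))
    (hd : Pairwise (Function.onFun Disjoint B)) (A : Set X) (hA : MeasurableSet A)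
    (hBA : ∀ i, B i ⊆ A) (f : Lp ℝ 2 ν) (hf : 0 ≤ f) :
    ∑ i ∈ s, J ν (B i) (hB i) f ≤ J ν A hA f := by
  simp only [J_apply]
  rw [← integral_biUnion_finset s (fun i _ => hB i) (fun i _ j _ hij => hd hij)
    (fun i _ => (int_Lp ν f).integrableOn)]
  apply setIntegral_mono_set (int_Lp ν f).integrableOn
  · exact ae_restrict_of_ae ((Lp.coeFn_nonneg f).2 hf)
  · exact (iUnion₂_subset fun i _ => hBA i).eventuallyLE

def K0 : Set (ℕ → WeakDual ℝ (Lp ℝ 2 ν)) :=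
  {T | (∀ i f, 0 ≤ f → 0 ≤ T i f) ∧
    ∀ (s : Finset ℕ) f, 0 ≤ f → ∑ i ∈ s, T i f ≤ J ν univ MeasurableSet.univ f}

theorem ev_cont (i : ℕ) (f : Lp ℝ 2 ν) :
    Continuous fun T : ℕ → WeakDual ℝ (Lp ℝ 2 ν) => T i f :=
  (WeakDual.eval_continuous f).comp (continuous_apply i)

theorem K0_closed : IsClosed (K0 ν) := by
  have : K0 ν = (⋂ i, ⋂ f, ⋂ (_ : 0 ≤ f), {T | 0 ≤ T i f}) ∩
    ⋂ s : Finset ℕ, ⋂ f, ⋂ (_ : 0 ≤ f),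
      {T | ∑ i ∈ s, T i f ≤ J ν univ MeasurableSet.univ f} := by
    ext T; simp [K0]
  rw [this]
  refine IsClosed.inter ?_ ?_
  · refine isClosed_iInter fun i => isClosed_iInter fun f => isClosed_iInter fun _ => ?_
    exact isClosed_le continuous_const (ev_cont ν i f)
  · refine isClosed_iInter fun i => isClosed_iInter fun f => isClosed_iInter fun _ => ?_
    exact isClosed_le (continuous_finsetSum _ fun i _ => ev_cont ν i f) continuous_const

theorem K0_bound (T) (hT : T ∈ K0 ν) (i : ℕ) (f : Lp ℝ 2 ν) :
    T i f ≤ ‖J ν univ MeasurableSet.univ‖ * ‖f‖ := by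
  have h1 : T i f = T i f⁺ - T i f⁻ := by
    rw [← map_sub, posPart_sub_negPart]
  have h2 : 0 ≤ T i f⁻ := hT.1 i _ (negPart_nonneg f)
  have h3 : T i f⁺ ≤ J ν univ MeasurableSet.univ f⁺ := by
    simpa using hT.2 {i} _ (posPart_nonneg f)
  have h4 : J ν univ MeasurableSet.univ f⁺ ≤ ‖J ν univ MeasurableSet.univ‖ * ‖f⁺‖ :=
    (le_abs_self _).trans ((J ν univ MeasurableSet.univ).le_opNorm _)
  have h5 : ‖f⁺‖ ≤ ‖f‖ := by
    apply norm_le_norm_of_abs_le_abs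
    rw [abs_of_nonneg (posPart_nonneg f)]
    rw [posPart_def]; exact sup_le (le_abs_self f) (abs_nonneg f)
  have := mul_le_mul_of_nonneg_left h5 (norm_nonneg (J ν univ MeasurableSet.univ))
  linarith

theorem K0_compact : IsCompact (K0 ν) := by
  have hc : IsCompact (Set.pi univ fun _ : ℕ =>
      (WeakDual.toStrongDual ⁻¹' Metric.closedBall 0 ‖J ν univ MeasurableSet.univ‖ :
        Set (WeakDual ℝ (Lp ℝ 2 ν)))) :=
    isCompact_univ_pi fun _ => WeakDual.isCompact_closedBall _ _
  refine hc.of_isClosed_subset (K0_closed ν) ?_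
  intro T hT i _
  simp only [mem_preimage, mem_closedBall_zero_iff]
  refine ContinuousLinearMap.opNorm_le_bound _ (norm_nonneg _) fun f => ?_
  rw [Real.norm_eq_abs, abs_le']
  refine ⟨K0_bound ν T hT i f, ?_⟩
  have := K0_bound ν T hT i (-f)
  rw [norm_neg, map_neg] at this
  exact this

theorem K0_convex : Convex ℝ (K0 ν) := by
  intro T hT S hS a b ha hb hab
  refine ⟨fun i f hf => ?_, fun s f hf => ?_⟩
  · have h1 := hT.1 i f hf
    have h2 := hS.1 i f hf
    change 0 ≤ a * T i f + b * S i f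
    positivity
  · have h1 := hT.2 s f hf
    have h2 := hS.2 s f hf
    change ∑ i ∈ s, (a * T i f + b * S i f) ≤ _
    rw [Finset.sum_add_distrib, ← Finset.mul_sum, ← Finset.mul_sum]
    calc _ ≤ a * J ν univ MeasurableSet.univ f + b * J ν univ MeasurableSet.univ f := by gcongr
      _ = _ := by rw [← add_mul, hab, one_mul]


theorem fin_exists (h : ℕ → Lp ℝ 2 ν) (c : ℝ)
    (hmax : ∀ (n : ℕ) (a : ℕ → ℝ), (∀ i, 0 ≤ a i) → ∃ T ∈ K0 ν,
      c * ∑ i ∈ Finset.range n, a i ≤ ∑ i ∈ Finset.range n, a i * T i (h i)) (n : ℕ) :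
    ∃ T ∈ K0 ν, ∀ i < n, c ≤ T i (h i) := by
  by_contra! hcon
  let Φ : (ℕ → WeakDual ℝ (Lp ℝ 2 ν)) → (Fin n → ℝ) := fun T i => T i (h i)
  have hlin : IsLinearMap ℝ Φ := ⟨fun _ _ => rfl, fun _ _ => rfl⟩
  have hcont : Continuous Φ := continuous_pi fun i => ev_cont ν i (h i)
  obtain ⟨f, u, v, hfu, huv, hvf⟩ := geometric_hahn_banach_compact_closed
    ((K0_convex ν).is_linear_image hlin) ((K0_compact ν).image hcont)
    (convex_Ici (𝕜 := ℝ) (fun _ : Fin n => c)) isClosed_Ici (by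
      rw [Set.disjoint_left]
      rintro _ ⟨T, hT, rfl⟩ hy
      obtain ⟨i, hi, hlt⟩ := hcon T hT
      exact absurd (hy ⟨i, hi⟩) (not_le.2 hlt))
  have hfsum : ∀ y : Fin n → ℝ, f y = ∑ i, y i * f (Pi.single i 1) := by
    intro y
    conv_lhs => rw [pi_eq_sum_univ' y]
    simp [map_sum, Pi.single]
  have hc := hvf (fun _ => c) self_mem_Ici
  have ha : ∀ i, 0 ≤ f (Pi.single i 1) := by
    intro i
    by_contra! hneg
    have hm : (0 : ℝ) ≤ (f (fun _ => c) - v) / (- f (Pi.single i 1)) :=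
      div_nonneg (by linarith) (by linarith)
    have := hvf ((fun _ => c) + ((f (fun _ => c) - v) / (- f (Pi.single i 1))) • Pi.single i 1)
      (by
        rw [mem_Ici]
        apply le_add_of_nonneg_right
        exact smul_nonneg hm (by simp))
    rw [map_add, map_smul, smul_eq_mul, div_neg, neg_mul, div_mul_cancel₀ _ hneg.ne] at this
    linarith
  obtain ⟨T, hT, hTle⟩ := hmax n (fun i => if hi : i < n then f (Pi.single ⟨i, hi⟩ 1) else 0)
    (by intro i; split_ifs; exacts [ha _, le_rfl])
  have h1 := hfu _ ⟨T, hT, rfl⟩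
  rw [hfsum] at h1 hc
  rw [Finset.sum_range, Finset.sum_range, Finset.mul_sum] at hTle
  simp only [Fin.is_lt, dif_pos, Fin.eta] at hTle
  simp only [Φ] at h1
  simp only [mul_comm (f _)] at hTle
  linarith

def K (h : ℕ → Lp ℝ 2 ν) (c : ℝ) : Set (ℕ → WeakDual ℝ (Lp ℝ 2 ν)) :=
  {T | T ∈ K0 ν ∧ ∀ i, c ≤ T i (h i)}

theorem exists_extreme (h : ℕ → Lp ℝ 2 ν) (c : ℝ)
    (hmax : ∀ (n : ℕ) (a : ℕ → ℝ), (∀ i, 0 ≤ a i) → ∃ T ∈ K0 ν,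
      c * ∑ i ∈ Finset.range n, a i ≤ ∑ i ∈ Finset.range n, a i * T i (h i)) :
    ((K ν h c).extremePoints ℝ).Nonempty := by
  have := wd_lc (Lp ℝ 2 ν)
  let S : ℕ → Set (ℕ → WeakDual ℝ (Lp ℝ 2 ν)) := fun n => K0 ν ∩ ⋂ i, ⋂ (_ : i < n), {T | c ≤ T i (h i)}
  have hcl : ∀ n, IsClosed (S n) := fun n => (K0_closed ν).inter <|
    isClosed_iInter fun i => isClosed_iInter fun _ => isClosed_le continuous_const (ev_cont ν i _)
  have hK : K ν h c = ⋂ n, S n := by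
    ext T
    simp only [K, S, mem_ofPred_eq, mem_iInter, mem_inter_iff]
    exact ⟨fun hT n => ⟨hT.1, fun i _ => hT.2 i⟩,
      fun hT => ⟨(hT 0).1, fun i => (hT (i+1)).2 i (Nat.lt_succ_self i)⟩⟩
  have hcomp : IsCompact (K ν h c) := by
    refine (K0_compact ν).of_isClosed_subset ?_ fun T hT => hT.1
    rw [hK]; exact isClosed_iInter hcl
  refine hcomp.extremePoints_nonempty ?_
  rw [hK]
  apply IsCompact.nonempty_iInter_of_sequence_nonempty_isCompact_isClosed
  · intro n T hT
    simp only [S, mem_ofPred_eq, mem_iInter, mem_inter_iff] at hT ⊢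
    exact ⟨hT.1, fun i hi => hT.2 i (by omega)⟩
  · intro n
    obtain ⟨T, hT, hT2⟩ := fin_exists ν h c hmax n
    refine ⟨T, hT, ?_⟩
    simpa using hT2
  · exact (K0_compact ν).of_isClosed_subset (hcl 0) inter_subset_left
  · exact hcl

theorem extreme_zero (h : ℕ → Lp ℝ 2 ν) (c : ℝ) (T) (hT : T ∈ (K ν h c).extremePoints ℝ)
    (i j : ℕ) (hij : i ≠ j) (P : WeakDual ℝ (Lp ℝ 2 ν))
    (hPi : ∀ f, 0 ≤ f → |P f| ≤ T i f) (hPj : ∀ f, 0 ≤ f → |P f| ≤ T j f)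
    (hi : P (h i) = 0) (hj : P (h j) = 0) : P = 0 := by
  rw [mem_extremePoints] at hT
  obtain ⟨hTK, hT⟩ := hT
  have key : ∀ Q : WeakDual ℝ (Lp ℝ 2 ν), (∀ f, 0 ≤ f → |Q f| ≤ T i f) →
      (∀ f, 0 ≤ f → |Q f| ≤ T j f) → Q (h i) = 0 → Q (h j) = 0 →
      (T + (Pi.single i Q - Pi.single j Q)) ∈ K ν h c := by
    intro Q hQi hQj hi hj
    have hval : ∀ l f, (T + (Pi.single i Q - Pi.single j Q) : ℕ → WeakDual ℝ (Lp ℝ 2 ν)) l f =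
        T l f + ((if l = i then Q f else 0) - (if l = j then Q f else 0)) := by
      intro l f
      change T l f + ((Pi.single i Q : ℕ → WeakDual ℝ (Lp ℝ 2 ν)) l f - (Pi.single j Q : ℕ → WeakDual ℝ (Lp ℝ 2 ν)) l f) = _
      congr 2
      · by_cases hl : l = i
        · subst hl; simp
        · simp only [Pi.single_eq_of_ne hl, if_neg hl]; rfl
      · by_cases hl : l = j
        · subst hl; simp
        · simp only [Pi.single_eq_of_ne hl, if_neg hl]; rfl
    refine ⟨⟨?_, ?_⟩, ?_⟩
    · intro l f hf
      rw [hval]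
      have h0 := hTK.1.1 l f hf
      have h1 := abs_le.1 (hQi f hf)
      have h2 := abs_le.1 (hQj f hf)
      by_cases hl : l = i
      · subst hl
        simp only [if_true, hij, if_false]; linarith
      · by_cases hl' : l = j
        · subst hl'; simp only [if_true, hl, if_false]; linarith
        · simp only [hl, hl', if_false]; linarith
    · intro s f hf
      simp only [hval]
      rw [Finset.sum_add_distrib, Finset.sum_sub_distrib, Finset.sum_ite_eq', Finset.sum_ite_eq']
      have h0 := hTK.1.2 s f hf
      have h1 := abs_le.1 (hQi f hf)
      have h2 := abs_le.1 (hQj f hf)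
      by_cases his : i ∈ s <;> by_cases hjs : j ∈ s <;> simp only [his, hjs, if_true, if_false]
      · linarith
      · have := hTK.1.2 (insert j s) f hf
        rw [Finset.sum_insert hjs] at this
        linarith
      · have := hTK.1.2 (insert i s) f hf
        rw [Finset.sum_insert his] at this
        linarith
      · linarith
    · intro l
      rw [hval]
      have := hTK.2 l
      split_ifs with h1 h2 h2
      · linarith
      · subst h1; linarith
      · subst h2; linarith
      · linarith
  have k1 := key P hPi hPj hi hj
  have k2 := key (-P) (fun f hf => by
      change |-(P f)| ≤ _
      rw [abs_neg]; exact hPi f hf)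
    (fun f hf => by
      change |-(P f)| ≤ _
      rw [abs_neg]; exact hPj f hf)
    (by change -(P _) = 0; rw [hi, neg_zero]) (by change -(P _) = 0; rw [hj, neg_zero])
  have := (hT _ k1 _ k2 ⟨1/2, 1/2, by norm_num, by norm_num, by norm_num, by
    rw [Pi.single_neg, Pi.single_neg]; module⟩).1
  have := congrFun this i
  simpa [hij] using this

theorem rep (T : WeakDual ℝ (Lp ℝ 2 ν)) : ∃ φ : Lp ℝ 2 ν, ∀ f, T f = inner ℝ φ f := by
  refine ⟨(InnerProductSpace.toDual ℝ (Lp ℝ 2 ν)).symm (WeakDual.toStrongDual T), fun f => ?_⟩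
  rw [InnerProductSpace.toDual_symm_apply]
  rfl

theorem inner_eq (φ f : Lp ℝ 2 ν) : inner ℝ φ f = ∫ x, φ x * f x ∂ν := by
  rw [L2.inner_def]
  congr 1; ext x
  simp [mul_comm]

theorem inner_int (φ f : Lp ℝ 2 ν) : Integrable (fun x => φ x * f x) ν := by
  have := L2.integrable_inner (𝕜 := ℝ) φ f
  refine this.congr (Filter.Eventually.of_forall fun x => ?_)
  simp [mul_comm]

theorem ind_nonneg (A : Set X) (hA : MeasurableSet A) :
    0 ≤ indicatorConstLp (μ := ν) 2 hA (measure_ne_top ν A) (1 : ℝ) := by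
  rw [← Lp.coeFn_nonneg]
  filter_upwards [indicatorConstLp_coeFn (μ := ν) (p := 2) (hs := hA)
    (hμs := measure_ne_top ν A) (c := (1 : ℝ))] with x hx
  rw [hx]
  exact indicator_nonneg (fun _ _ => zero_le_one) x

theorem J_ind (A B : Set X) (hA : MeasurableSet A) (hB : MeasurableSet B) :
    J ν B hB (indicatorConstLp (μ := ν) 2 hA (measure_ne_top ν A) (1 : ℝ)) = ν.real (A ∩ B) := by
  rw [J_apply, setIntegral_indicatorConstLp hB]
  simp

theorem rep_bounds (T) (hT : T ∈ K0 ν) (i : ℕ) (φ : Lp ℝ 2 ν) (hφ : ∀ f, T i f = inner ℝ φ f) :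
    (∀ᵐ x ∂ν, 0 ≤ φ x) ∧ ∀ᵐ x ∂ν, φ x ≤ 1 := by
  have hval : ∀ (A : Set X) (hA : MeasurableSet A),
      T i (indicatorConstLp (μ := ν) 2 hA (measure_ne_top ν A) (1 : ℝ)) = ∫ x in A, φ x ∂ν := by
    intro A hA
    rw [hφ, real_inner_comm, L2.inner_indicatorConstLp_one]
  constructor
  · refine ae_nonneg_of_forall_setIntegral_nonneg (int_Lp ν φ) fun A hA _ => ?_
    rw [← hval A hA]
    exact hT.1 i _ (ind_nonneg ν A hA)
  · refine ae_le_of_forall_setIntegral_le (int_Lp ν φ) (integrable_const 1) fun A hA _ => ?_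
    rw [← hval A hA]
    have := hT.2 {i} _ (ind_nonneg ν A hA)
    rw [Finset.sum_singleton, J_ind] at this
    simpa using this

theorem J_le_T (T : WeakDual ℝ (Lp ℝ 2 ν)) (φ : Lp ℝ 2 ν) (hφ : ∀ f, T f = inner ℝ φ f)
    (h0 : ∀ᵐ x ∂ν, 0 ≤ φ x) (A : Set X) (hA : MeasurableSet A) (ε : ℝ)
    (hε : ∀ x ∈ A, ε ≤ φ x) (f : Lp ℝ 2 ν) (hf : 0 ≤ f) :
    ε * J ν A hA f ≤ T f := by
  rw [hφ, inner_eq, J_apply, ← integral_const_mul, ← integral_indicator hA]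
  have hf' := (Lp.coeFn_nonneg f).2 hf
  refine integral_mono_ae (((int_Lp ν f).const_mul ε).indicator hA) (inner_int ν φ f) ?_
  filter_upwards [h0, hf'] with x hx hfx
  have hfx : 0 ≤ f x := hfx
  by_cases hxA : x ∈ A
  · rw [indicator_of_mem hxA]
    exact mul_le_mul_of_nonneg_right (hε x hxA) hfx
  · rw [indicator_of_notMem hxA]
    exact mul_nonneg hx hfx

theorem exists_kernel (p q : Fin 3 → ℝ) (ε : ℝ) (hε : 0 < ε) :
    ∃ c : Fin 3 → ℝ, c ≠ 0 ∧ (∀ l, |c l| ≤ ε) ∧ ∑ l, c l * p l = 0 ∧ ∑ l, c l * q l = 0 := by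
  let L : (Fin 3 → ℝ) →ₗ[ℝ] (Fin 2 → ℝ) := Matrix.mulVecLin !![p 0, p 1, p 2; q 0, q 1, q 2]
  have hker : L.ker ≠ ⊥ := LinearMap.ker_ne_bot_of_finrank_lt (by simp)
  obtain ⟨c, hc, hc0⟩ := Submodule.exists_mem_ne_zero_of_ne_bot hker
  rw [LinearMap.mem_ker] at hc
  have e0 := congrFun hc 0
  have e1 := congrFun hc 1
  simp [L, Matrix.mulVec, dotProduct, Fin.sum_univ_three] at e0 e1
  have hn : 0 < ‖c‖ := norm_pos_iff.2 hc0
  refine ⟨(ε / ‖c‖) • c, ?_, ?_, ?_, ?_⟩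
  · exact smul_ne_zero (by positivity) hc0
  · intro l
    have := norm_le_pi_norm c l
    rw [Real.norm_eq_abs] at this
    simp only [Pi.smul_apply, smul_eq_mul, abs_mul]
    rw [abs_of_pos (by positivity), div_mul_eq_mul_div, div_le_iff₀ hn]
    gcongr
  · simp only [Pi.smul_apply, smul_eq_mul, Fin.sum_univ_three]
    linear_combination (ε / ‖c‖) * e0
  · simp only [Pi.smul_apply, smul_eq_mul, Fin.sum_univ_three]
    linear_combination (ε / ‖c‖) * e1

theorem extreme_disj [MeasurableSpace.CountablySeparated X] (hν : ∀ x, ν {x} = 0)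
    (h : ℕ → Lp ℝ 2 ν) (c : ℝ) (T) (hT : T ∈ (K ν h c).extremePoints ℝ)
    (i j : ℕ) (hij : i ≠ j) (φ ψ : Lp ℝ 2 ν) (hφ : ∀ f, T i f = inner ℝ φ f)
    (hψ : ∀ f, T j f = inner ℝ ψ f) (ε : ℝ) (hε : 0 < ε) :
    ν ({x | ε ≤ φ x} ∩ {x | ε ≤ ψ x}) = 0 := by
  by_contra hpos
  have hTK : T ∈ K ν h c := hT.1
  set A := {x | ε ≤ φ x} ∩ {x | ε ≤ ψ x} with hAdef
  have hA : MeasurableSet A :=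
    (measurableSet_le measurable_const (Lp.stronglyMeasurable φ).measurable).inter
      (measurableSet_le measurable_const (Lp.stronglyMeasurable ψ).measurable)
  obtain ⟨B, hBA, hB, hB0, hBd⟩ := split_three ν hν A hA hpos
  obtain ⟨k, hk0, hkε, hki, hkj⟩ := exists_kernel (fun l => J ν (B l) (hB l) (h i))
    (fun l => J ν (B l) (hB l) (h j)) ε hε
  let P' : Lp ℝ 2 ν →L[ℝ] ℝ := ∑ l, k l • J ν (B l) (hB l)
  have hP' : ∀ f, P' f = ∑ l, k l * J ν (B l) (hB l) f := by
    intro f; simp [P']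
  have hle : ∀ f, 0 ≤ f → |P' f| ≤ ε * J ν A hA f := by
    intro f hf
    rw [hP']
    calc _ ≤ ∑ l, |k l * J ν (B l) (hB l) f| := Finset.abs_sum_le_sum_abs _ _
      _ ≤ ∑ l, ε * J ν (B l) (hB l) f := by
        refine Finset.sum_le_sum fun l _ => ?_
        have := J_nonneg ν (B l) (hB l) f hf
        rw [abs_mul, abs_of_nonneg this]
        exact mul_le_mul_of_nonneg_right (hkε l) this
      _ = ε * ∑ l, J ν (B l) (hB l) f := by rw [Finset.mul_sum]
      _ ≤ _ := mul_le_mul_of_nonneg_left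
        (J_sum_le ν Finset.univ B hB hBd A hA hBA f hf) hε.le
  have hP0 := extreme_zero ν h c T hT i j hij (StrongDual.toWeakDual P')
    (fun f hf => (hle f hf).trans (J_le_T ν (T i) φ hφ (rep_bounds ν T hTK.1 i φ hφ).1 A hA ε
      (fun x hx => hx.1) f hf))
    (fun f hf => (hle f hf).trans (J_le_T ν (T j) ψ hψ (rep_bounds ν T hTK.1 j ψ hψ).1 A hA ε
      (fun x hx => hx.2) f hf))
    ((hP' _).trans hki) ((hP' _).trans hkj)
  apply hk0
  ext l
  have h1 : P' (indicatorConstLp (μ := ν) 2 (hB l) (measure_ne_top ν (B l)) (1 : ℝ)) = 0 := by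
    change (StrongDual.toWeakDual P') _ = 0
    rw [hP0]; rfl
  rw [hP', Finset.sum_eq_single l] at h1
  · rw [J_ind, inter_self] at h1
    rcases mul_eq_zero.1 h1 with h2 | h2
    · simpa using h2
    · exact absurd h2 (by simpa [measureReal_eq_zero_iff] using hB0 l)
  · intro m _ hm
    rw [J_ind, (hBd hm.symm : Disjoint (B l) (B m)).inter_eq]
    simp
  · simp

theorem core_sets [MeasurableSpace.CountablySeparated X] (hν : ∀ x, ν {x} = 0)
    (h : ℕ → Lp ℝ 2 ν) (hh : ∀ i, 0 ≤ h i) (c : ℝ)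
    (hmax : ∀ (n : ℕ) (a : ℕ → ℝ), (∀ i, 0 ≤ a i) → ∃ T ∈ K0 ν,
      c * ∑ i ∈ Finset.range n, a i ≤ ∑ i ∈ Finset.range n, a i * T i (h i)) :
    ∃ E : ℕ → Set X, (∀ i, MeasurableSet (E i)) ∧ Pairwise (Function.onFun Disjoint E) ∧
      ∀ i, c ≤ ∫ x in E i, h i x ∂ν := by
  obtain ⟨T, hT⟩ := exists_extreme ν h c hmax
  choose φ hφ using fun i => rep ν (T i)
  let S : ℕ → Set X := fun i => {x | 0 < φ i x}
  have hS : ∀ i, MeasurableSet (S i) := fun i =>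
    measurableSet_lt measurable_const (Lp.stronglyMeasurable (φ i)).measurable
  have hd : Pairwise (Function.onFun (AEDisjoint ν) S) := by
    intro i j hij
    refine measure_mono_null (t := ⋃ n : ℕ, ({x | 1 / ((n : ℝ) + 1) ≤ φ i x} ∩
      {x | 1 / ((n : ℝ) + 1) ≤ φ j x})) ?_ (measure_iUnion_null fun n =>
        extreme_disj ν hν h c T hT i j hij (φ i) (φ j) (hφ i) (hφ j) _ (by positivity))
    rintro x ⟨hx1, hx2⟩
    change 0 < φ i x at hx1
    change 0 < φ j x at hx2
    obtain ⟨n, hn⟩ := exists_nat_one_div_lt (lt_min hx1 hx2)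
    rw [mem_iUnion]
    exact ⟨n, (hn.trans_le (min_le_left _ _)).le, (hn.trans_le (min_le_right _ _)).le⟩
  obtain ⟨t, ht, ht0, htd⟩ := exists_null_pairwise_disjoint_sdiff hd
  refine ⟨fun i => S i \ t i, fun i => (hS i).diff (ht i), htd, fun i => ?_⟩
  have hb := rep_bounds ν T hT.1.1 i (φ i) (hφ i)
  have hhi := (Lp.coeFn_nonneg (h i)).2 (hh i)
  rw [setIntegral_congr_set (sdiff_null_ae_eq_self (ht0 i)), ← integral_indicator (hS i)]
  refine (hT.1.2 i).trans ?_
  rw [hφ, inner_eq]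
  refine integral_mono_ae (inner_int ν _ _) ((int_Lp ν (h i)).indicator (hS i)) ?_
  filter_upwards [hb.1, hb.2, hhi] with x h0 h1 hx
  have hx : 0 ≤ h i x := hx
  by_cases hxS : x ∈ S i
  · rw [indicator_of_mem hxS]
    exact mul_le_of_le_one_left hx h1
  · rw [indicator_of_notMem hxS]
    have : φ i x ≤ 0 := not_lt.1 hxS
    exact mul_nonpos_of_nonpos_of_nonneg this hx

theorem core_enn [MeasurableSpace.CountablySeparated X] (hν : ∀ x, ν {x} = 0)
    (G : ℕ → X → ℝ≥0∞) (hG : ∀ i, Measurable (G i)) (M : ℕ → ℝ≥0) (hM : ∀ i x, G i x ≤ M i)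
    (C : ℝ≥0) (hC : 1 ≤ C)
    (hyp : ∀ a : ℕ → ℝ≥0, ∑' i, (a i : ℝ≥0∞) ≤ (C : ℝ≥0∞) * ∫⁻ x, ⨆ i, (a i : ℝ≥0∞) * G i x ∂ν) :
    ∃ E : ℕ → Set X, (∀ i, MeasurableSet (E i)) ∧ Pairwise (Function.onFun Disjoint E) ∧
      ∀ i, (1 : ℝ≥0∞) ≤ (C : ℝ≥0∞) * ∫⁻ x in E i, G i x ∂ν := by
  have hfin : ∀ i x, G i x < ∞ := fun i x => (hM i x).trans_lt ENNReal.coe_lt_top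
  have hmem : ∀ i, MemLp (fun x => (G i x).toReal) 2 ν := by
    intro i
    refine MemLp.of_bound (hG i).ennreal_toReal.aestronglyMeasurable (M i : ℝ)
      (Filter.Eventually.of_forall fun x => ?_)
    rw [Real.norm_of_nonneg ENNReal.toReal_nonneg]
    simpa using ENNReal.toReal_mono ENNReal.coe_ne_top (hM i x)
  let h : ℕ → Lp ℝ 2 ν := fun i => (hmem i).toLp
  have hh : ∀ i, 0 ≤ h i := by
    intro i
    rw [← Lp.coeFn_nonneg]
    filter_upwards [(hmem i).coeFn_toLp] with x hx
    rw [hx]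
    exact ENNReal.toReal_nonneg
  have hlt : ∀ i (A : Set X), ∫⁻ x in A, G i x ∂ν < ∞ := by
    intro i A
    calc _ ≤ ∫⁻ x in A, (M i : ℝ≥0∞) ∂ν := lintegral_mono (hM i)
      _ < ∞ := by
        rw [setLIntegral_const]
        exact ENNReal.mul_lt_top ENNReal.coe_lt_top (measure_lt_top _ _)
  have hIntEq : ∀ i (A : Set X), ∫ x in A, h i x ∂ν = (∫⁻ x in A, G i x ∂ν).toReal := by
    intro i A
    rw [integral_congr_ae (ae_restrict_of_ae (hmem i).coeFn_toLp)]
    exact integral_toReal (hG i).aemeasurable (Filter.Eventually.of_forall (hfin i))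
  have hCpos : (0 : ℝ) < C := by
    have : (1 : ℝ) ≤ C := by exact_mod_cast hC
    linarith
  obtain ⟨E, hE, hEd, hE1⟩ := core_sets ν hν h hh (1 / (C : ℝ)) (by
    intro n a ha
    let b : ℕ → ℝ≥0 := fun i => if i < n then (a i).toNNReal else 0
    let D : ℕ → Set X := fun i => {x | i < n ∧ ∀ j < n, (b j : ℝ≥0∞) * G j x ≤ b i * G i x}
    have hD : ∀ i, MeasurableSet (D i) := by
      intro i
      have : D i = {x | i < n} ∩ ⋂ j, ⋂ (_ : j < n), {x | (b j : ℝ≥0∞) * G j x ≤ b i * G i x} := by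
        ext x; simp [D]
      rw [this]
      refine (MeasurableSet.const _).inter (MeasurableSet.iInter fun j => MeasurableSet.iInter fun _ => ?_)
      exact measurableSet_le ((hG j).const_mul _) ((hG i).const_mul _)
    have hB : ∀ i, MeasurableSet (disjointed D i) := fun i => MeasurableSet.disjointed hD i
    refine ⟨fun i => StrongDual.toWeakDual (J ν (disjointed D i) (hB i)), ⟨?_, ?_⟩, ?_⟩
    · intro i f hf
      exact J_nonneg ν _ _ f hf
    · intro s f hf
      exact J_sum_le ν s (disjointed D) hB (disjoint_disjointed D) univ _
        (fun _ => subset_univ _) f hf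
    · change _ ≤ ∑ i ∈ Finset.range n, a i * J ν (disjointed D i) (hB i) (h i)
      simp only [J_apply, hIntEq]
      have key : ∑ i ∈ Finset.range n, (b i : ℝ≥0∞) ≤
          C * ∑ i ∈ Finset.range n, b i * ∫⁻ x in disjointed D i, G i x ∂ν := by
        calc _ ≤ ∑' i, (b i : ℝ≥0∞) := ENNReal.sum_le_tsum _
          _ ≤ _ := hyp b
          _ ≤ C * ∫⁻ x, ∑ i ∈ Finset.range n,
              (disjointed D i).indicator (fun x => (b i : ℝ≥0∞) * G i x) x ∂ν := by
            gcongr with x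
            refine iSup_le fun j => ?_
            by_cases hj : j < n
            · obtain ⟨i, hi, him⟩ := Finset.exists_max_image (Finset.range n)
                (fun i => (b i : ℝ≥0∞) * G i x) ⟨j, Finset.mem_range.2 hj⟩
              have hx : x ∈ ⋃ i, D i := mem_iUnion.2 ⟨i, Finset.mem_range.1 hi,
                fun j hj => him j (Finset.mem_range.2 hj)⟩
              rw [← iUnion_disjointed] at hx
              obtain ⟨l, hl⟩ := mem_iUnion.1 hx
              have hlD := disjointed_subset D l hl
              refine (hlD.2 j hj).trans ?_
              refine le_trans ?_ (Finset.single_le_sum (fun _ _ => zero_le)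
                (Finset.mem_range.2 hlD.1))
              rw [indicator_of_mem hl]
            · simp [b, hj]
          _ = _ := by
            congr 1
            rw [lintegral_finsetSum _ fun i _ => ((hG i).const_mul _).indicator (hB i)]
            refine Finset.sum_congr rfl fun i _ => ?_
            rw [lintegral_indicator (hB i), lintegral_const_mul _ (hG i)]
      have key2 := ENNReal.toReal_mono (ENNReal.mul_ne_top ENNReal.coe_ne_top
        (ENNReal.sum_ne_top.2 fun i _ => ENNReal.mul_ne_top ENNReal.coe_ne_top (hlt i _).ne)) key
      rw [ENNReal.toReal_mul, ENNReal.toReal_sum (fun i _ => ENNReal.coe_ne_top),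
        ENNReal.toReal_sum
          (fun i _ => ENNReal.mul_ne_top ENNReal.coe_ne_top (hlt i _).ne)] at key2
      have hb : ∀ i ∈ Finset.range n, (b i : ℝ) = a i := by
        intro i hi
        simp only [b, if_pos (Finset.mem_range.1 hi)]
        exact Real.coe_toNNReal _ (ha i)
      simp only [ENNReal.toReal_mul, ENNReal.coe_toReal] at key2
      rw [one_div, inv_mul_le_iff₀ hCpos]
      refine (Finset.sum_congr rfl hb).symm.trans_le (key2.trans_eq ?_)
      congr 1
      exact Finset.sum_congr rfl fun i hi => by rw [hb i hi])
  refine ⟨E, hE, hEd, fun i => ?_⟩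
  have := hE1 i
  rw [hIntEq, div_le_iff₀' hCpos] at this
  rw [← ENNReal.toReal_le_toReal ENNReal.one_ne_top
    (ENNReal.mul_ne_top ENNReal.coe_ne_top (hlt i _).ne), ENNReal.toReal_mul]
  simpa using this

theorem core_general [MeasurableSpace.CountablySeparated X] (μ : Measure X) (hμ : ∀ x, μ {x} = 0)
    (G : ℕ → X → ℝ≥0∞) (hG : ∀ i, Measurable (G i)) (hfin : ∀ i, ∫⁻ x, G i x ∂μ ≠ ∞)
    (C : ℝ≥0) (hC : 1 ≤ C)
    (hyp : ∀ a : ℕ → ℝ≥0, ∑' i, (a i : ℝ≥0∞) ≤ (C : ℝ≥0∞) * ∫⁻ x, ⨆ i, (a i : ℝ≥0∞) * G i x ∂μ) :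
    ∃ E : ℕ → Set X, (∀ i, MeasurableSet (E i)) ∧ Pairwise (Function.onFun Disjoint E) ∧
      ∀ i, (1 : ℝ≥0∞) ≤ (C : ℝ≥0∞) * ∫⁻ x in E i, G i x ∂μ := by
  obtain ⟨δ, hδ, hδs⟩ := ENNReal.exists_pos_tsum_mul_lt_of_countable one_ne_zero _ hfin
  let w : X → ℝ≥0∞ := fun x => ∑' i, G i x * δ i
  have hw : Measurable w := Measurable.ennreal_tsum fun i => (hG i).mul_const _
  have hwi : ∫⁻ x, w x ∂μ < ∞ := by
    rw [lintegral_tsum fun i => ((hG i).mul_const _).aemeasurable]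
    simp_rw [lintegral_mul_const _ (hG _)]
    exact hδs.trans ENNReal.one_lt_top
  have hwfin : ∀ᵐ x ∂μ, w x < ∞ := ae_lt_top hw hwi.ne
  have hle : ∀ i x, G i x * δ i ≤ w x := fun i x => ENNReal.le_tsum i
  have hδ0 : ∀ i, (δ i : ℝ≥0∞) ≠ 0 := fun i => by exact_mod_cast (hδ i).ne'
  let F : ℕ → X → ℝ≥0∞ := fun i x => G i x / w x
  have hF : ∀ i, Measurable (F i) := fun i => (hG i).div hw
  have hFM : ∀ i x, F i x ≤ ((δ i)⁻¹ : ℝ≥0) := by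
    intro i x
    rw [ENNReal.coe_inv (hδ i).ne']
    apply ENNReal.div_le_of_le_mul
    calc G i x = (δ i : ℝ≥0∞)⁻¹ * (G i x * δ i) := by
          rw [mul_comm (G i x), ← mul_assoc, ENNReal.inv_mul_cancel (hδ0 i) ENNReal.coe_ne_top,
            one_mul]
      _ ≤ _ := by gcongr; exact hle i x
  have hFw : ∀ᵐ x ∂μ, ∀ i, w x * F i x = G i x := by
    filter_upwards [hwfin] with x hx i
    by_cases h0 : w x = 0
    · have := hle i x
      rw [h0, nonpos_iff_eq_zero, mul_eq_zero] at this
      rw [h0, zero_mul, this.resolve_right (hδ0 i)]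
    · exact ENNReal.mul_div_cancel h0 hx.ne
  have : IsFiniteMeasure (μ.withDensity w) := isFiniteMeasure_withDensity hwi.ne
  obtain ⟨E, hE, hEd, hE1⟩ := core_enn (μ.withDensity w)
    (fun x => withDensity_absolutelyContinuous μ w (hμ x)) F hF (fun i => (δ i)⁻¹) hFM C hC (by
      intro a
      refine (hyp a).trans_eq ?_
      congr 1
      rw [lintegral_withDensity_eq_lintegral_mul μ hw (Measurable.iSup fun i => (hF i).const_mul _)]
      refine lintegral_congr_ae ?_
      filter_upwards [hFw] with x hx
      simp only [Pi.mul_apply, ENNReal.mul_iSup]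
      refine iSup_congr fun i => ?_
      rw [← hx i]; ring)
  refine ⟨E, hE, hEd, fun i => (hE1 i).trans_eq ?_⟩
  congr 1
  rw [restrict_withDensity (hE i), lintegral_withDensity_eq_lintegral_mul _ hw (hF i)]
  refine lintegral_congr_ae (ae_restrict_of_ae ?_)
  filter_upwards [hFw] with x hx
  exact hx i

theorem easy (μ : Measure X)
    (G : ℕ → X → ℝ≥0∞) (hG : ∀ i, Measurable (G i)) (C : ℝ≥0)
    (E : ℕ → Set X) (hE : ∀ i, MeasurableSet (E i)) (hd : Pairwise (Function.onFun Disjoint E))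
    (h1 : ∀ i, (1 : ℝ≥0∞) ≤ (C : ℝ≥0∞) * ∫⁻ x in E i, G i x ∂μ) (a : ℕ → ℝ≥0) :
    ∑' i, (a i : ℝ≥0∞) ≤ (C : ℝ≥0∞) * ∫⁻ x, ⨆ i, (a i : ℝ≥0∞) * G i x ∂μ := by
  calc ∑' i, (a i : ℝ≥0∞) ≤ ∑' i, C * ∫⁻ x in E i, ⨆ i, (a i : ℝ≥0∞) * G i x ∂μ := by
        refine ENNReal.tsum_le_tsum fun i => ?_
        calc (a i : ℝ≥0∞) = a i * 1 := (mul_one _).symm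
          _ ≤ a i * (C * ∫⁻ x in E i, G i x ∂μ) := by gcongr; exact h1 i
          _ = C * ∫⁻ x in E i, a i * G i x ∂μ := by
            rw [lintegral_const_mul _ (hG i)]; ring
          _ ≤ _ := by
            gcongr with x
            exact le_iSup (fun i => (a i : ℝ≥0∞) * G i x) i
    _ = C * ∫⁻ x in ⋃ i, E i, ⨆ i, (a i : ℝ≥0∞) * G i x ∂μ := by
        rw [ENNReal.tsum_mul_left, lintegral_iUnion hE hd]
    _ ≤ _ := by gcongr; exact Measure.restrict_le_self

end

end DorAux

/-- Dor's Proposition 2.2, generalized. For a locally finite Borel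
measure `μ` on `ℝ^d` without point masses and a sequence of non-negative measurable
functions `g i ∈ L¹(μ)`, the estimate `∑ a i ≤ C ∫ sup_i a_i g_i dμ` holds for all
non-negative sequences `a` iff there are pairwise disjoint measurable sets `E i`
with `1 ≤ C ∫_{E i} g_i dμ`. -/
theorem dor_characterization {d : ℕ} (μ : Measure (Fin d → ℝ)) [IsLocallyFiniteMeasure μ]
    (hμ : ∀ x : Fin d → ℝ, μ {x} = 0)
    (g : ℕ → (Fin d → ℝ) → ℝ) (hgmeas : ∀ i, Measurable (g i))
    (hg0 : ∀ i x, 0 ≤ g i x) (hgint : ∀ i, Integrable (g i) μ)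
    (C : ℝ≥0) (hC : 1 ≤ C) :
    (∀ a : ℕ → ℝ≥0, ∑' i, (a i : ℝ≥0∞) ≤
        (C : ℝ≥0∞) * ∫⁻ x, ⨆ i, (a i : ℝ≥0∞) * ENNReal.ofReal (g i x) ∂μ) ↔
      (∃ E : ℕ → Set (Fin d → ℝ), (∀ i, MeasurableSet (E i)) ∧
        Pairwise (Function.onFun Disjoint E) ∧
        ∀ i, (1 : ℝ≥0∞) ≤ (C : ℝ≥0∞) * ∫⁻ x in E i, ENNReal.ofReal (g i x) ∂μ) := by
  constructor
  · intro hyp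
    exact DorAux.core_general μ hμ (fun i x => ENNReal.ofReal (g i x))
      (fun i => (hgmeas i).ennreal_ofReal) (fun i => (hgint i).lintegral_lt_top.ne) C hC hyp
  · rintro ⟨E, hE, hd, h1⟩ a
    exact DorAux.easy μ (fun i x => ENNReal.ofReal (g i x))
      (fun i => (hgmeas i).ennreal_ofReal) C E hE hd h1 a
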